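/- arXiv:1403.1616 — 3 statements merged into one kernel-verified Lean document; each statement's English description precedes it below -/
import Mathlib

section
/- For every n ≥ 4, the prism Pr_n is not 2-word-representable. -/
/-- Two letters `x` and `y` alternate in the word `w` if, after deleting all letters
other than `x` and `y`, no two equal letters are consecutive. -/
def Alternate {V : Type*} [DecidableEq V] (w : List V) (x y : V) : Prop :=
  (w.filter (fun z => decide (z = x ∨ z = y))).Chain' (· ≠ ·)

/-- A word `w` represents the graph `G` if every vertex occurs in `w` and two distinct
vertices alternate in `w` exactly when they are adjacent in `G`. -/
def Represents {V : Type*} [DecidableEq V] (w : List V) (G : SimpleGraph V) : Prop :=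
  (∀ v : V, v ∈ w) ∧ ∀ x y : V, x ≠ y → (Alternate w x y ↔ G.Adj x y)

/-- A graph is word-representable if some word represents it. -/
def WordRepresentable {V : Type*} [DecidableEq V] (G : SimpleGraph V) : Prop :=
  ∃ w : List V, Represents w G

/-- A word is `k`-uniform if every letter occurs in it exactly `k` times. -/
def KUniform {V : Type*} [DecidableEq V] (k : ℕ) (w : List V) : Prop :=
  ∀ v : V, w.count v = k

/-- A graph is `k`-word-representable if some `k`-uniform word represents it. -/
def KRepresentable {V : Type*} [DecidableEq V] (G : SimpleGraph V) (k : ℕ) : Prop :=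
  ∃ w : List V, KUniform k w ∧ Represents w G

/-- The representation number of a graph: the least `k` such that it is
`k`-word-representable. -/
noncomputable def reprNum {V : Type*} [DecidableEq V] (G : SimpleGraph V) : ℕ :=
  sInf {k | KRepresentable G k}

/-- The prism `Pr n`: two `n`-cycles `1-2-⋯-n-1` and `1'-2'-⋯-n'-1'` together with the
rungs `(i, i')`. Vertices `Sum.inl i` are the unprimed ones, `Sum.inr i` the primed ones. -/
def prism (n : ℕ) : SimpleGraph (Fin n ⊕ Fin n) :=
  SimpleGraph.fromRel (fun a b =>
    match a, b with
    | Sum.inl i, Sum.inl j => (j : ℕ) = ((i : ℕ) + 1) % n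
    | Sum.inr i, Sum.inr j => (j : ℕ) = ((i : ℕ) + 1) % n
    | Sum.inl i, Sum.inr j => i = j
    | _, _ => False)

/-- A filtered word is read off along the increasing list of the positions that are kept. -/
theorem filter_eq_map_get {V : Type*} (w : List V) (P : V → Bool) (l : List (Fin w.length))
    (hl : l.Pairwise (· < ·)) (h : ∀ i, i ∈ l ↔ P (w.get i) = true) :
    w.filter P = l.map w.get := by
  have hfin : (List.finRange w.length).filter (P ∘ w.get) = l := by
    have hs : ((List.finRange w.length).filter (P ∘ w.get)).Pairwise (· < ·) :=
      (List.pairwise_lt_finRange _).filter _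
    refine List.Perm.eq_of_pairwise (le := (· < ·)) (fun a b _ _ hab hba => absurd hab hba.asymm)
      hs hl ?_
    rw [List.perm_ext_iff_of_nodup (hs.imp ne_of_lt) (hl.imp ne_of_lt)]
    intro i
    simp [h]
  conv_lhs => rw [← List.map_get_finRange w]
  rw [List.filter_map, hfin]

/-- In a `2`-uniform word every letter has a first and a second position. -/
theorem KUniform.exists_positions {V : Type*} [DecidableEq V] {w : List V} (hw : KUniform 2 w) :
    ∃ p q : V → Fin w.length, ∀ v, p v < q v ∧ ∀ i, w.get i = v ↔ i = p v ∨ i = q v := by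
  have key : ∀ v, ∃ p q : Fin w.length, p < q ∧ ∀ i, w.get i = v ↔ i = p ∨ i = q := by
    intro v
    set l := (List.finRange w.length).filter (fun i => decide (w.get i = v)) with hl
    have hs : l.Pairwise (· < ·) := (List.pairwise_lt_finRange _).filter _
    have hmem : ∀ i, i ∈ l ↔ w.get i = v := by simp [hl]
    have hlen : l.length = 2 := by
      have := filter_eq_map_get w (fun u => decide (u = v)) l hs (by simpa using hmem)
      rw [← hw v, List.count_eq_length_filter]
      have h2 := congrArg List.length this
      rw [List.length_map] at h2
      rw [← h2]
      congr 1
    obtain ⟨a, b, hab⟩ := List.length_eq_two.1 hlen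
    rw [hab] at hs hmem
    exact ⟨a, b, by simpa using hs, fun i => by rw [← hmem]; simp⟩
  choose p q h using key
  exact ⟨p, q, h⟩

/-- Two letters of a `2`-uniform word alternate exactly when their chords cross. -/
theorem alternate_iff_crossing {V : Type*} [DecidableEq V] {w : List V} {p q : V → Fin w.length}
    (h : ∀ v, p v < q v ∧ ∀ i, w.get i = v ↔ i = p v ∨ i = q v) {x y : V} (hxy : x ≠ y) :
    Alternate w x y ↔ (p x < p y ∧ p y < q x ∧ q x < q y) ∨
      (p y < p x ∧ p x < q y ∧ q y < q x) := by
  obtain ⟨hx, hx'⟩ := h x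
  obtain ⟨hy, hy'⟩ := h y
  have gx : w.get (p x) = x := (hx' _).2 (Or.inl rfl)
  have gx' : w.get (q x) = x := (hx' _).2 (Or.inr rfl)
  have gy : w.get (p y) = y := (hy' _).2 (Or.inl rfl)
  have gy' : w.get (q y) = y := (hy' _).2 (Or.inr rfl)
  have h1 : p x ≠ p y := fun e => hxy (by rw [← gx, e, gy])
  have h2 : p x ≠ q y := fun e => hxy (by rw [← gx, e, gy'])
  have h3 : q x ≠ p y := fun e => hxy (by rw [← gx', e, gy])
  have h4 : q x ≠ q y := fun e => hxy (by rw [← gx', e, gy'])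
  have key : ∀ l : List (Fin w.length), l.Pairwise (· < ·) →
      (∀ i, i ∈ l ↔ (i = p x ∨ i = q x) ∨ (i = p y ∨ i = q y)) →
      (Alternate w x y ↔ (l.map w.get).IsChain (· ≠ ·)) := by
    intro l hl hmem
    unfold Alternate
    rw [filter_eq_map_get w _ l hl (by intro i; rw [hmem, ← hx', ← hy']; simp)]
    rfl
  rcases lt_or_gt_of_ne h1 with h1 | h1 <;> rcases lt_or_gt_of_ne h2 with h2 | h2 <;>
    rcases lt_or_gt_of_ne h3 with h3 | h3 <;> rcases lt_or_gt_of_ne h4 with h4 | h4 <;>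
    first
    | (exfalso; omega)
    | (rw [key [p x, q x, p y, q y] (by simp; omega) (by simp; tauto)]
       simp only [List.map_cons, List.map_nil, gx, gx', gy, gy']; simp; omega)
    | (rw [key [p x, p y, q x, q y] (by simp; omega) (by simp; tauto)]
       simp only [List.map_cons, List.map_nil, gx, gx', gy, gy']; simp [hxy, hxy.symm]; omega)
    | (rw [key [p x, p y, q y, q x] (by simp; omega) (by simp; tauto)]
       simp only [List.map_cons, List.map_nil, gx, gx', gy, gy']; simp [hxy, hxy.symm]; omega)
    | (rw [key [p y, q y, p x, q x] (by simp; omega) (by simp; tauto)]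
       simp only [List.map_cons, List.map_nil, gx, gx', gy, gy']; simp; omega)
    | (rw [key [p y, p x, q y, q x] (by simp; omega) (by simp; tauto)]
       simp only [List.map_cons, List.map_nil, gx, gx', gy, gy']; simp [hxy, hxy.symm]; omega)
    | (rw [key [p y, p x, q x, q y] (by simp; omega) (by simp; tauto)]
       simp only [List.map_cons, List.map_nil, gx, gx', gy, gy']; simp [hxy, hxy.symm]; omega)

/-- A chord diagram: the vertices of `G` are chords with endpoints `p v < q v` that together use
each of the points `0, …, N - 1` once, and adjacency is crossing. -/
structure IsChordDiagram {V : Type*} (G : SimpleGraph V) (N : ℕ) (p q : V → ℕ) : Prop where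
  lt : ∀ v, p v < q v
  lt_size : ∀ v, q v < N
  exists_endpoint : ∀ i < N, ∃ v, i = p v ∨ i = q v
  disjoint : ∀ u v, u ≠ v → p u ≠ p v ∧ p u ≠ q v ∧ q u ≠ p v ∧ q u ≠ q v
  adj_iff : ∀ u v, u ≠ v → (G.Adj u v ↔ (p u < p v ∧ p v < q u ∧ q u < q v) ∨
    (p v < p u ∧ p u < q v ∧ q v < q u))

/-- A `2`-uniform word that represents `G` is a chord diagram of `G`. -/
theorem Represents.exists_isChordDiagram {V : Type*} [DecidableEq V] {G : SimpleGraph V}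
    {w : List V} (hw : Represents w G) (hu : KUniform 2 w) :
    ∃ p q : V → ℕ, IsChordDiagram G w.length p q := by
  obtain ⟨p, q, h⟩ := hu.exists_positions
  have gp : ∀ v, w.get (p v) = v := fun v => ((h v).2 _).2 (Or.inl rfl)
  have gq : ∀ v, w.get (q v) = v := fun v => ((h v).2 _).2 (Or.inr rfl)
  refine ⟨fun v => p v, fun v => q v, fun v => (h v).1, fun v => (q v).2, fun i hi => ?_,
    fun u v huv => ?_, fun u v huv => ?_⟩
  · refine ⟨w.get ⟨i, hi⟩, ?_⟩
    simpa [Fin.ext_iff] using ((h (w.get ⟨i, hi⟩)).2 ⟨i, hi⟩).1 rfl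
  · simp only [ne_eq, Fin.val_inj]
    refine ⟨fun e => huv ?_, fun e => huv ?_, fun e => huv ?_, fun e => huv ?_⟩
    · rw [← gp u, e, gp]
    · rw [← gp u, e, gq]
    · rw [← gq u, e, gp]
    · rw [← gq u, e, gq]
  · rw [← hw.2 u v huv, alternate_iff_crossing h huv]
    rfl

namespace IsChordDiagram

variable {V : Type*} {G : SimpleGraph V} {N : ℕ} {p q : V → ℕ}

/-- A connected set of chords that do not cross `v` lies on one side of `v`. -/
theorem inside_of_preconnected (h : IsChordDiagram G N p q) {v : V}
    (hc : (G.induce {u | u ≠ v ∧ ¬ G.Adj v u}).Preconnected) {x y : V}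
    (hx : x ≠ v ∧ ¬ G.Adj v x) (hy : y ≠ v ∧ ¬ G.Adj v y)
    (hin : p v < p x ∧ q x < q v) : p v < p y ∧ q y < q v := by
  have hr := hc ⟨x, hx⟩ ⟨y, hy⟩
  rw [SimpleGraph.reachable_iff_reflTransGen] at hr
  suffices ∀ z : {u | u ≠ v ∧ ¬ G.Adj v u},
      Relation.ReflTransGen (G.induce {u | u ≠ v ∧ ¬ G.Adj v u}).Adj ⟨x, hx⟩ z →
      p v < p z.1 ∧ q z.1 < q v from this ⟨y, hy⟩ hr
  intro z hz
  induction hz with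
  | refl => exact hin
  | @tail b c _ hbc ih =>
    have hbc' : G.Adj b.1 c.1 := hbc
    have h1 := (h.adj_iff _ _ hbc'.ne).1 hbc'
    have h2 := mt (h.adj_iff _ _ c.2.1.symm).2 c.2.2
    have h3 := h.disjoint _ _ c.2.1
    have := h.lt c.1
    omega

/-- If the non-neighbours of a vertex of degree three are connected, then one of the two arcs cut
off by its chord has exactly three points. -/
theorem short_arc (h : IsChordDiagram G N p q) {v a b c : V}
    (hc : (G.induce {u | u ≠ v ∧ ¬ G.Adj v u}).Preconnected)
    (hab : a ≠ b) (hac : a ≠ c) (hbc : b ≠ c)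
    (hn : ∀ u, G.Adj v u ↔ u = a ∨ u = b ∨ u = c) :
    q v = p v + 4 ∨ q v + 4 = p v + N := by
  have cross : ∀ u, G.Adj v u → (p v < p u ∧ p u < q v ∧ q v < q u) ∨
    (p u < p v ∧ p v < q u ∧ q u < q v) := fun u hu => (h.adj_iff _ _ hu.ne).1 hu
  have hv := h.lt v
  have hvN := h.lt_size v
  have three : ∀ (S : Finset ℕ) (e : V → ℕ), (∀ u, e u = p u ∨ e u = q u) →
      (∀ u, G.Adj v u → e u ∈ S) → (∀ i ∈ S, ∃ u, G.Adj v u ∧ i = e u) → S.card = 3 := by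
    intro S e he heS hSe
    have hinj : ∀ x y, x ≠ y → e x ≠ e y := by
      intro x y hxy
      have := h.disjoint x y hxy
      rcases he x with hx | hx <;> rcases he y with hy | hy <;> rw [hx, hy] <;> tauto
    refine Finset.card_eq_three.2 ⟨e a, e b, e c, hinj a b hab, hinj a c hac, hinj b c hbc, ?_⟩
    ext i
    simp only [Finset.mem_insert, Finset.mem_singleton]
    constructor
    · intro hi
      obtain ⟨u, hu, rfl⟩ := hSe i hi
      rcases (hn u).1 hu with rfl | rfl | rfl <;> simp
    · rintro (rfl | rfl | rfl) <;> exact heS _ ((hn _).2 (by simp))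
  by_cases hin : ∃ x, (x ≠ v ∧ ¬ G.Adj v x) ∧ p v < p x ∧ q x < q v
  · right
    obtain ⟨x, hx, hxin⟩ := hin
    have hcard := three (Finset.range (p v) ∪ Finset.Ioo (q v) N)
      (fun u => if p v < p u then q u else p u) (fun u => by split_ifs <;> simp)
      (fun u hu => by
        have := cross u hu
        have := h.lt_size u
        simp only [Finset.mem_union, Finset.mem_range, Finset.mem_Ioo]
        split_ifs <;> omega)
      (fun i hi => by
        simp only [Finset.mem_union, Finset.mem_range, Finset.mem_Ioo] at hi
        obtain ⟨u, hu⟩ := h.exists_endpoint i (by omega)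
        have huv : u ≠ v := by rintro rfl; omega
        have hlu := h.lt u
        by_cases hadj : G.Adj v u
        · have hcu := cross u hadj
          refine ⟨u, hadj, ?_⟩
          split_ifs <;> omega
        · have := h.inside_of_preconnected hc hx ⟨huv, hadj⟩ hxin
          omega)
    rw [Finset.card_union_of_disjoint, Finset.card_range, Nat.card_Ioo] at hcard
    · omega
    · rw [Finset.disjoint_left]
      intro i
      simp only [Finset.mem_range, Finset.mem_Ioo]
      omega
  · left
    have hcard := three (Finset.Ioo (p v) (q v))
      (fun u => if p v < p u then p u else q u) (fun u => by split_ifs <;> simp)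
      (fun u hu => by
        have := cross u hu
        simp only [Finset.mem_Ioo]
        split_ifs <;> omega)
      (fun i hi => by
        simp only [Finset.mem_Ioo] at hi
        obtain ⟨u, hu⟩ := h.exists_endpoint i (by omega)
        have huv : u ≠ v := by rintro rfl; omega
        have hlu := h.lt u
        by_cases hadj : G.Adj v u
        · have hcu := cross u hadj
          refine ⟨u, hadj, ?_⟩
          split_ifs <;> omega
        · have h1 := mt (h.adj_iff _ _ huv.symm).2 hadj
          have h2 := h.disjoint _ _ huv
          exact absurd ⟨u, ⟨huv, hadj⟩, by omega⟩ hin)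
    rw [Nat.card_Ioo] at hcard
    omega

/-- A triangle-free cubic graph in which the non-neighbours of every vertex are connected has no
chord diagram with at least eight chords. -/
theorem false_of_cubic (h : IsChordDiagram G N p q) (hN : 16 ≤ N)
    (hcubic : ∀ v, ∃ a b c, a ≠ b ∧ a ≠ c ∧ b ≠ c ∧ ∀ u, G.Adj v u ↔ u = a ∨ u = b ∨ u = c)
    (htri : ∀ x y z, G.Adj x y → G.Adj x z → ¬ G.Adj y z)
    (hc : ∀ v, (G.induce {u | u ≠ v ∧ ¬ G.Adj v u}).Preconnected) : False := by
  have short : ∀ v, q v = p v + 4 ∨ q v + 4 = p v + N := by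
    intro v
    obtain ⟨a, b, c, hab, hac, hbc, hn⟩ := hcubic v
    exact h.short_arc (hc v) hab hac hbc hn
  obtain ⟨v, hv⟩ := h.exists_endpoint 8 (by omega)
  obtain ⟨a, b, c, hab, hac, hbc, hn⟩ := hcubic v
  have hvN := h.lt_size v
  have hv4 : q v = p v + 4 := by have := short v; omega
  have near : ∀ u, G.Adj v u → q u = p u + 4 ∧ p u ≠ p v ∧ p u < p v + 4 ∧ p v < p u + 4 := by
    intro u hu
    have h1 := (h.adj_iff _ _ hu.ne).1 hu
    have h2 := short u
    have h3 := h.lt_size u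
    omega
  have opposite : ∀ x y, x ≠ y → G.Adj v x → G.Adj v y → (p x < p v ↔ p v < p y) := by
    intro x y hxy hx hy
    have h1 := near x hx
    have h2 := near y hy
    have h3 := h.disjoint x y hxy
    have h4 := mt (h.adj_iff x y hxy).2 (htri v x y hx hy)
    omega
  have ha := (hn a).2 (by simp)
  have hb := (hn b).2 (by simp)
  have hc' := (hn c).2 (by simp)
  have h1 := opposite a b hab ha hb
  have h2 := opposite a c hac ha hc'
  have h3 := opposite b c hbc hb hc'
  have h4 := near a ha
  have h5 := near b hb
  have h6 := near c hc'
  omega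

end IsChordDiagram

/-- Adjacency in a cycle on `Fin n`, without reduction modulo `n`. -/
theorem Fin.val_eq_succ_mod_iff {n : ℕ} (i j : Fin n) :
    (j : ℕ) = ((i : ℕ) + 1) % n ↔
      (j : ℕ) = i + 1 ∨ ((j : ℕ) = 0 ∧ (i : ℕ) + 1 = n) := by
  rcases Nat.lt_or_ge ((i : ℕ) + 1) n with h | h
  · rw [Nat.mod_eq_of_lt h]
    omega
  · have hn : (i : ℕ) + 1 = n := by omega
    rw [hn, Nat.mod_self]
    omega

/-- `i` and `j` are consecutive, in some order, on the cycle `0, …, n - 1`. -/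
def CycleAdj {n : ℕ} (i j : Fin n) : Prop :=
  ((j : ℕ) = i + 1 ∨ ((j : ℕ) = 0 ∧ (i : ℕ) + 1 = n)) ∨
    ((i : ℕ) = j + 1 ∨ ((i : ℕ) = 0 ∧ (j : ℕ) + 1 = n))

section Prism

variable {n : ℕ}

theorem prism_adj_inl_inl (hn : 4 ≤ n) (i j : Fin n) :
    (prism n).Adj (Sum.inl i) (Sum.inl j) ↔ CycleAdj i j := by
  simp only [prism, SimpleGraph.fromRel_adj, Fin.val_eq_succ_mod_iff, CycleAdj, ne_eq,
    Sum.inl.injEq, Fin.ext_iff]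
  omega

theorem prism_adj_inr_inr (hn : 4 ≤ n) (i j : Fin n) :
    (prism n).Adj (Sum.inr i) (Sum.inr j) ↔ CycleAdj i j := by
  simp only [prism, SimpleGraph.fromRel_adj, Fin.val_eq_succ_mod_iff, CycleAdj, ne_eq,
    Sum.inr.injEq, Fin.ext_iff]
  omega

theorem prism_adj_inl_inr (i j : Fin n) :
    (prism n).Adj (Sum.inl i) (Sum.inr j) ↔ i = j := by
  simp [prism, SimpleGraph.fromRel_adj]

theorem prism_adj_inr_inl (i j : Fin n) :
    (prism n).Adj (Sum.inr i) (Sum.inl j) ↔ i = j := by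
  rw [SimpleGraph.adj_comm, prism_adj_inl_inr, eq_comm]

theorem prism_triangle_free (hn : 4 ≤ n) (x y z : Fin n ⊕ Fin n) (hxy : (prism n).Adj x y)
    (hxz : (prism n).Adj x z) : ¬ (prism n).Adj y z := by
  rcases x with i | i <;> rcases y with j | j <;> rcases z with k | k <;>
    simp only [prism_adj_inl_inl hn, prism_adj_inr_inr hn, prism_adj_inl_inr, prism_adj_inr_inl,
      CycleAdj, Fin.ext_iff] at hxy hxz ⊢ <;> omega

/-- Every index has exactly two neighbours on the cycle. -/
theorem exists_cycleAdj_iff (hn : 4 ≤ n) (i : Fin n) :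
    ∃ j k : Fin n, j ≠ k ∧ ∀ l, CycleAdj i l ↔ l = j ∨ l = k := by
  refine ⟨⟨if (i : ℕ) + 1 = n then 0 else i + 1, by split_ifs <;> omega⟩,
    ⟨if (i : ℕ) = 0 then n - 1 else i - 1, by split_ifs <;> omega⟩, ?_, fun l => ?_⟩
  · simp only [ne_eq, Fin.ext_iff]
    split_ifs <;> omega
  · simp only [CycleAdj, Fin.ext_iff]
    split_ifs <;> omega

theorem prism_cubic (hn : 4 ≤ n) (v : Fin n ⊕ Fin n) :
    ∃ a b c, a ≠ b ∧ a ≠ c ∧ b ≠ c ∧ ∀ u, (prism n).Adj v u ↔ u = a ∨ u = b ∨ u = c := by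
  rcases v with i | i <;> obtain ⟨j, k, hjk, h⟩ := exists_cycleAdj_iff hn i
  · refine ⟨Sum.inr i, Sum.inl j, Sum.inl k, by simp, by simp, by simpa using hjk, ?_⟩
    rintro (l | l)
    · simp [prism_adj_inl_inl hn, h]
    · simp [prism_adj_inl_inr, eq_comm]
  · refine ⟨Sum.inl i, Sum.inr j, Sum.inr k, by simp, by simp, by simpa using hjk, ?_⟩
    rintro (l | l)
    · simp [prism_adj_inr_inl, eq_comm]
    · simp [prism_adj_inr_inr hn, h]

/-- In a graph made of two `n`-cycles `s` and `t` and the rungs between them, the vertices that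
are neither `s i` nor adjacent to it are connected. -/
theorem preconnected_nonneighbours {V : Type*} {G : SimpleGraph V} {s t : Fin n → V}
    (ht : ∀ i j, G.Adj (t i) (t j) ↔ CycleAdj i j)
    (hst : ∀ i j, G.Adj (s i) (t j) ↔ i = j)
    (hne : ∀ i j, t i ≠ s j) (hcover : ∀ v, (∃ i, v = s i) ∨ ∃ i, v = t i) (i : Fin n) :
    (G.induce {u | u ≠ s i ∧ ¬ G.Adj (s i) u}).Preconnected := by
  set H := G.induce {u | u ≠ s i ∧ ¬ G.Adj (s i) u} with hH
  have hmem : ∀ j, j ≠ i → t j ∈ {u | u ≠ s i ∧ ¬ G.Adj (s i) u} := fun j hj =>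
    ⟨hne j i, by rw [hst]; exact hj.symm⟩
  have step : ∀ (j k : Fin n) (hj : j ≠ i) (hk : k ≠ i), CycleAdj j k →
      H.Reachable ⟨t j, hmem j hj⟩ ⟨t k, hmem k hk⟩ := by
    intro j k hj hk hjk
    exact SimpleGraph.Adj.reachable ((ht j k).2 hjk)
  have up : ∀ (d : ℕ) (j k : Fin n) (hj : j ≠ i) (hk : k ≠ i), (k : ℕ) = j + d →
      ((i : ℕ) < j ∨ (k : ℕ) < i) → H.Reachable ⟨t j, hmem j hj⟩ ⟨t k, hmem k hk⟩ := by
    intro d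
    induction d with
    | zero =>
      intro j k hj hk hjk _
      obtain rfl : j = k := Fin.ext (by omega)
      rfl
    | succ d ih =>
      intro j k hj hk hjk hside
      have hm : (⟨j + d, by omega⟩ : Fin n) ≠ i := by
        rw [ne_eq, Fin.ext_iff]
        simp only
        omega
      refine (ih j ⟨j + d, by omega⟩ hj hm rfl (by simp only; omega)).trans
        (step _ _ hm hk ?_)
      simp only [CycleAdj]
      omega
  have lt : ∀ (j k : Fin n) (hj : j ≠ i) (hk : k ≠ i), j < k →
      H.Reachable ⟨t j, hmem j hj⟩ ⟨t k, hmem k hk⟩ := by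
    intro j k hj hk hjk
    have hj' := hj
    have hk' := hk
    rw [ne_eq, Fin.ext_iff] at hj' hk'
    by_cases hside : (i : ℕ) < j ∨ (k : ℕ) < i
    · exact up (k - j) j k hj hk (by omega) hside
    · have h0 : (⟨0, by omega⟩ : Fin n) ≠ i := by
        rw [ne_eq, Fin.ext_iff]
        simp only
        omega
      have h1 : (⟨n - 1, by omega⟩ : Fin n) ≠ i := by
        rw [ne_eq, Fin.ext_iff]
        simp only
        omega
      refine ((up j ⟨0, by omega⟩ j h0 hj (by simp) (by omega)).symm.trans
        (step _ ⟨n - 1, by omega⟩ h0 h1 ?_)).trans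
        (up (n - 1 - k) k ⟨n - 1, by omega⟩ hk h1 (by simp only; omega) (by omega)).symm
      exact Or.inr (Or.inr ⟨rfl, by simp only; omega⟩)
  have all : ∀ (j k : Fin n) (hj : j ≠ i) (hk : k ≠ i),
      H.Reachable ⟨t j, hmem j hj⟩ ⟨t k, hmem k hk⟩ := by
    intro j k hj hk
    rcases lt_trichotomy j k with hjk | rfl | hjk
    · exact lt j k hj hk hjk
    · rfl
    · exact (lt k j hk hj hjk).symm
  have toRung : ∀ u : {u | u ≠ s i ∧ ¬ G.Adj (s i) u},
      ∃ (j : Fin n) (hj : j ≠ i), H.Reachable u ⟨t j, hmem j hj⟩ := by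
    rintro ⟨u, hu⟩
    rcases hcover u with ⟨j, rfl⟩ | ⟨j, rfl⟩
    · have hj : j ≠ i := by
        rintro rfl
        exact hu.1 rfl
      exact ⟨j, hj, SimpleGraph.Adj.reachable ((hst j j).2 rfl)⟩
    · have hj : j ≠ i := by
        rintro rfl
        exact hu.2 ((hst j j).2 rfl)
      exact ⟨j, hj, by rfl⟩
  intro u u'
  obtain ⟨j, hj, h1⟩ := toRung u
  obtain ⟨k, hk, h2⟩ := toRung u'
  exact (h1.trans (all j k hj hk)).trans h2.symm

theorem prism_preconnected_nonneighbours (hn : 4 ≤ n) (v : Fin n ⊕ Fin n) :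
    ((prism n).induce {u | u ≠ v ∧ ¬ (prism n).Adj v u}).Preconnected := by
  rcases v with i | i
  · exact preconnected_nonneighbours (s := Sum.inl) (t := Sum.inr) (prism_adj_inr_inr hn)
      prism_adj_inl_inr (by simp) (by rintro (v | v) <;> simp) i
  · exact preconnected_nonneighbours (s := Sum.inr) (t := Sum.inl) (prism_adj_inl_inl hn)
      prism_adj_inr_inl (by simp) (by rintro (v | v) <;> simp) i

end Prism

/-- A `k`-uniform word has `k` letters for each vertex. -/
theorem KUniform.length_eq {V : Type*} [DecidableEq V] [Fintype V] {k : ℕ} {w : List V}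
    (hw : KUniform k w) : w.length = Fintype.card V * k := by
  have h := Multiset.sum_count_eq_card (s := Finset.univ) (m := (w : Multiset V)) (by simp)
  simpa [hw _] using h.symm

/-- For every `n ≥ 4`, the prism `Pr n` is not 2-word-representable. -/
theorem prism_not_two_word_representable (n : ℕ) (hn : 4 ≤ n) :
    ¬ KRepresentable (prism n) 2 := by
  rintro ⟨w, hu, hw⟩
  obtain ⟨p, q, h⟩ := hw.exists_isChordDiagram hu
  refine h.false_of_cubic ?_ (prism_cubic hn) (prism_triangle_free hn)
    (prism_preconnected_nonneighbours hn)
  rw [hu.length_eq, Fintype.card_sum, Fintype.card_fin]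
  omega
end

section
/- Let k ≥ 2, let G be a word-representable graph with representation number R(G) = k, let x be a vertex of G, and let G' be the graph obtained from G by adding one new vertex y together with the single edge (x,y). Then G' is word-representable and R(G') = k. -/
theorem alternate_comm {V : Type*} [DecidableEq V] {w : List V} {p q : V} :
    Alternate w p q ↔ Alternate w q p := by
  simp only [Alternate, or_comm]

theorem alternate_reverse {V : Type*} [DecidableEq V] {w : List V} {p q : V} :
    Alternate w.reverse p q ↔ Alternate w p q := by
  change List.IsChain _ _ ↔ List.IsChain _ _
  simp only [List.filter_reverse, List.isChain_reverse, ne_comm]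

/-- In an alternating two-letter word starting with `p`, the last letter is determined by
comparing the numbers of occurrences of the two letters. -/
theorem getLast_and_count_of_isChain_ne {V : Type*} [DecidableEq V] {p q : V} {l : List V}
    (hpq : p ≠ q) (hl : ∀ z ∈ l, z = p ∨ z = q) (hc : (p :: l).IsChain (· ≠ ·)) :
    (p :: l).getLast (List.cons_ne_nil _ _) = p ∧ l.count p = l.count q ∨
    (p :: l).getLast (List.cons_ne_nil _ _) = q ∧ l.count q = l.count p + 1 := by
  induction l generalizing p q with
  | nil => simp
  | cons c l ih =>
    rw [List.isChain_cons_cons] at hc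
    have hcq : c = q := (hl c (by simp)).resolve_left hc.1.symm
    subst hcq
    have := ih hpq.symm (fun z hz => (hl z (by simp [hz])).symm) hc.2
    simp only [List.getLast_cons_cons, List.count_cons_self, List.count_cons_of_ne hc.1.symm]
    rcases this with h | h
    · right; exact ⟨h.1, by omega⟩
    · left; exact ⟨h.1, by omega⟩

theorem alternate_append_singleton_of_cons {V : Type*} [DecidableEq V] {a p q : V}
    {u : List V} (hpq : p ≠ q) (hcount : (a :: u).count p = (a :: u).count q)
    (h : Alternate (a :: u) p q) : Alternate (u ++ [a]) p q := by
  wlog ha : a ≠ q generalizing p q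
  · exact alternate_comm.1 (this hpq.symm hcount.symm (alternate_comm.1 h)
      (by push Not at ha; exact ha ▸ hpq.symm))
  change List.IsChain _ _ at h
  change List.IsChain _ _
  by_cases hap : a = p
  · subst hap
    simp only [List.filter_append, List.filter_cons, true_or, decide_true, if_true,
      List.filter_nil] at h ⊢
    rw [List.count_cons_self, List.count_cons_of_ne ha] at hcount
    have hlast := getLast_and_count_of_isChain_ne hpq (by simp) h
    rw [List.count_filter (by simp), List.count_filter (by simp)] at hlast
    have hq := (hlast.resolve_left (by omega)).1
    have := List.IsChain.append h (List.isChain_singleton a) (by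
      intro y hy z hz
      rw [List.getLast?_eq_getLast_of_ne_nil (List.cons_ne_nil _ _), hq] at hy
      simp at hy hz
      subst hy hz
      exact hpq.symm)
    exact this.tail
  · simpa [List.filter_append, List.filter_cons, hap, ha] using h

theorem alternate_append_singleton_iff {V : Type*} [DecidableEq V] {a p q : V}
    {u : List V} (hpq : p ≠ q) (hcount : (a :: u).count p = (a :: u).count q) :
    Alternate (u ++ [a]) p q ↔ Alternate (a :: u) p q := by
  refine ⟨fun h => ?_, alternate_append_singleton_of_cons hpq hcount⟩
  rw [← alternate_reverse] at h ⊢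
  simp only [List.reverse_append, List.reverse_cons, List.reverse_nil, List.nil_append,
    List.singleton_append] at h ⊢
  exact alternate_append_singleton_of_cons hpq
    (by simpa only [List.count_cons, List.count_reverse] using hcount) h

/-- Uniform representing words may be shifted cyclically. -/
theorem kUniform_and_represents_append_comm {V : Type*} [DecidableEq V] {G : SimpleGraph V}
    {k : ℕ} {u v : List V} (h : KUniform k (u ++ v) ∧ Represents (u ++ v) G) :
    KUniform k (v ++ u) ∧ Represents (v ++ u) G := by
  induction u generalizing v with
  | nil => simpa using h
  | cons a u ih =>
    rw [List.cons_append] at h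
    have := ih (v := v ++ [a]) (by
      rw [← List.append_assoc]
      refine ⟨fun z => ?_, fun z => ?_, fun p q hpq => ?_⟩
      · rw [← h.1 z]
        exact (List.perm_append_singleton a (u ++ v)).count_eq z
      · exact (List.perm_append_singleton a (u ++ v)).mem_iff.2 (h.2.1 z)
      · rw [alternate_append_singleton_iff hpq ((h.1 p).trans (h.1 q).symm)]
        exact h.2.2 p q hpq)
    simpa using this

theorem alternate_some_iff {V : Type*} [DecidableEq V] {l : List (Option V)} {a b : V} :
    Alternate l (some a) (some b) ↔ Alternate l.reduceOption a b := by
  have key : l.filter (fun z => decide (z = some a ∨ z = some b)) =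
      (l.reduceOption.filter (fun z => decide (z = a ∨ z = b))).map some := by
    induction l with
    | nil => rfl
    | cons c l ih =>
      cases c with
      | none => simpa using ih
      | some c =>
        by_cases hc : c = a ∨ c = b <;>
          simpa [hc] using ih
  change List.IsChain _ _ ↔ List.IsChain _ _
  rw [key, List.isChain_map]
  simp

theorem count_reduceOption {V : Type*} [DecidableEq V] [BEq (Option V)]
    [LawfulBEq (Option V)] (l : List (Option V)) (v : V) :
    l.reduceOption.count v = l.count (some v) := by
  induction l with
  | nil => rfl
  | cons c l ih => cases c <;> simp [List.count_cons, ih]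

theorem KRepresentable.of_option {V : Type*} [DecidableEq V] {G : SimpleGraph V}
    {G' : SimpleGraph (Option V)} {k : ℕ}
    (hadj : ∀ a b : V, G'.Adj (some a) (some b) ↔ G.Adj a b) (h : KRepresentable G' k) :
    KRepresentable G k := by
  obtain ⟨l, hu, hm, hr⟩ := h
  refine ⟨l.reduceOption, fun v => ?_, fun v => ?_, fun a b hab => ?_⟩
  · exact (@count_reduceOption V _ instBEqOfDecidableEq _ l v).trans (hu (some v))
  · exact List.reduceOption_mem_iff.2 (hm (some v))
  · rw [← alternate_some_iff, hr _ _ (by simpa using hab), hadj]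

/-- Insert the new letter `none` in front of every occurrence of `x`. -/
def insertNone {V : Type*} [DecidableEq V] (x : V) : List V → List (Option V)
  | [] => []
  | v :: l => if v = x then none :: some v :: insertNone x l else some v :: insertNone x l

theorem reduceOption_insertNone {V : Type*} [DecidableEq V] (x : V) (l : List V) :
    (insertNone x l).reduceOption = l := by
  induction l with
  | nil => rfl
  | cons v l ih => by_cases hv : v = x <;> simp [insertNone, hv, ih]

theorem count_none_insertNone {V : Type*} [DecidableEq V] [BEq (Option V)]
    [LawfulBEq (Option V)] (x : V) (l : List V) :
    (insertNone x l).count none = l.count x := by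
  induction l with
  | nil => rfl
  | cons v l ih => by_cases hv : v = x <;> simp [insertNone, hv, ih]

theorem isChain_filter_insertNone {V : Type*} [DecidableEq V] (x : V) (l : List V) :
    (some x :: (insertNone x l ++ [none]).filter
      (fun z => decide (z = some x ∨ z = none))).IsChain (· ≠ ·) := by
  induction l with
  | nil => simp [insertNone]
  | cons v l ih =>
    by_cases hv : v = x
    · subst hv
      simpa [insertNone] using ih
    · simpa [insertNone, hv] using ih

/-- In a uniform word, two letters do not alternate if one of them is both the first and the last
of their occurrences. -/
theorem KUniform.not_alternate {V : Type*} [DecidableEq V] {k : ℕ} {w l : List V} {p q : V}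
    (hw : KUniform k w) (hpq : p ≠ q)
    (hl : w.filter (fun z => decide (z = q ∨ z = p)) = p :: (l ++ [p])) :
    ¬ Alternate w q p := by
  intro hc
  change List.IsChain _ _ at hc
  have hp : (p :: (l ++ [p])).count p = k := by rw [← hl, List.count_filter (by simp), hw]
  have hq : (p :: (l ++ [p])).count q = k := by rw [← hl, List.count_filter (by simp), hw]
  rw [hl] at hc
  have hmem : ∀ z ∈ l ++ [p], z = p ∨ z = q := fun z hz => by
    have := hl ▸ List.mem_cons_of_mem p hz
    simpa [or_comm] using (List.mem_filter.1 this).2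
  rw [List.count_cons_self] at hp
  rw [List.count_cons_of_ne hpq] at hq
  rcases getLast_and_count_of_isChain_ne hpq hmem hc with h | h
  · omega
  · exact hpq (by simpa using h.1)

theorem KRepresentable.add_pendant {V : Type*} [DecidableEq V] {G : SimpleGraph V}
    {G' : SimpleGraph (Option V)} {k : ℕ} {x : V} (hk : 2 ≤ k)
    (hadj : ∀ a b : V, G'.Adj (some a) (some b) ↔ G.Adj a b)
    (hleaf : ∀ a : V, G'.Adj (some a) none ↔ a = x) (h : KRepresentable G k) :
    KRepresentable G' k := by
  obtain ⟨w, hw⟩ := h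
  obtain ⟨s, t, rfl⟩ := List.append_of_mem (hw.2.1 x)
  obtain ⟨hu, hm, hr⟩ := kUniform_and_represents_append_comm hw
  rw [List.cons_append] at hu hm hr
  generalize t ++ s = r at hu hm hr
  have hx : r.count x + 1 = k := by simpa using hu x
  obtain ⟨P, Q, rfl, hP⟩ := List.eq_append_cons_of_mem
    (List.count_pos_iff.1 (by omega : 0 < r.count x))
  have hQ : Q.count x + 2 = k := by
    simpa [List.count_eq_zero_of_not_mem hP] using hx
  set W : List (Option V) :=
    some x :: none :: (P.map some ++ some x :: insertNone x Q ++ [none]) with hW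
  have hmap : (P.map some).reduceOption = P := by
    simp [List.reduceOption, List.filterMap_map]
  have hred : W.reduceOption = x :: (P ++ x :: Q) := by
    simp [hW, List.reduceOption_append, reduceOption_insertNone, hmap]
  have hWu : KUniform k W := by
    have hn [BEq (Option V)] [LawfulBEq (Option V)] : W.count none = k := by
      have hPn : (P.map some).count (none : Option V) = 0 :=
        List.count_eq_zero_of_not_mem (by simp)
      simp [hW, List.count_append, count_none_insertNone, hPn]
      omega
    rintro (_ | v)
    · exact @hn instBEqOfDecidableEq inferInstance
    · rw [← hu v, ← hred]
      exact (@count_reduceOption V _ instBEqOfDecidableEq _ W v).symm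
  have hnone (a : V) : Alternate W (some a) none ↔ a = x := by
    constructor
    · contrapose!
      intro hax
      refine hWu.not_alternate (by simp) (l := (P.map some ++ some x :: insertNone x Q).filter
        (fun z => decide (z = some a ∨ z = none))) ?_
      simp [hW, Ne.symm hax]
    · rintro rfl
      change List.IsChain _ _
      have hPn : (P.map some).filter (fun z => decide (z = some a ∨ z = none)) = [] := by
        rw [List.filter_eq_nil_iff]
        rintro z hz
        obtain ⟨b, hb, rfl⟩ := List.mem_map.1 hz
        have : b ≠ a := fun h => hP (h ▸ hb)
        simpa using this
      have := isChain_filter_insertNone a Q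
      simp only [hW, List.filter_cons, List.filter_append, hPn, List.append_assoc,
        List.cons_append, List.nil_append] at this ⊢
      simpa using this
  refine ⟨W, hWu, ?_, ?_⟩
  · rintro (_ | v)
    · simp [hW]
    · exact List.reduceOption_mem_iff.1 (hred ▸ hm v)
  rintro (_ | a) (_ | b) hab
  · exact absurd rfl hab
  · rw [alternate_comm, hnone, G'.adj_comm, hleaf]
  · rw [hnone, hleaf]
  · rw [alternate_some_iff, hred, hr a b (by simpa using hab), hadj]

/-- Let `k ≥ 2`, let `G` be word-representable with representation number `k`, and let
`G'` (on vertex set `Option V`, the new vertex being `none`) be obtained from `G` by adding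
the new vertex `none` together with the single edge to `x`. Then `G'` is word-representable
with representation number `k`. -/
theorem reprNum_add_pendant_of_two_le {V : Type*} [DecidableEq V]
    (G : SimpleGraph V) (k : ℕ) (hk : 2 ≤ k)
    (hG : WordRepresentable G) (hR : reprNum G = k) (x : V)
    (G' : SimpleGraph (Option V))
    (hadj : ∀ a b : V, G'.Adj (some a) (some b) ↔ G.Adj a b)
    (hleaf : ∀ a : V, G'.Adj (some a) none ↔ a = x) :
    WordRepresentable G' ∧ reprNum G' = k := by
  have hset : {j | KRepresentable G' j}.Nonempty → k ≤ reprNum G' := fun hne =>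
    le_csInf hne fun j hj => hR ▸ Nat.sInf_le (KRepresentable.of_option hadj hj)
  have hGk : KRepresentable G k := by
    have hne : {j | KRepresentable G j}.Nonempty :=
      Nat.nonempty_of_pos_sInf (show 0 < reprNum G by omega)
    exact hR ▸ Nat.sInf_mem hne
  have hG'k : KRepresentable G' k := hGk.add_pendant hk hadj hleaf
  exact ⟨hG'k.imp fun _ h => h.2, le_antisymm (Nat.sInf_le hG'k) (hset ⟨k, hG'k⟩)⟩
end

section
/- Let G1 = (V1,E1) and G2 = (V2,E2) be vertex-disjoint word-representable graphs with |V1| ≥ 2 and |V2| ≥ 2, with representation numbers R(G1) = k1 and R(G2) = k2, and let x ∈ V1 and y ∈ V2. Let G' be the graph (V1 ∪ V2, E1 ∪ E2 ∪ {(x,y)}) obtained by connecting G1 and G2 by the edge (x,y). Then G' is word-representable and R(G') = max(k1, k2, 2). -/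
section Alternation

variable {V W : Type*} [DecidableEq V] [DecidableEq W]

theorem alternate_iff {w : List V} {a b : V} : Alternate w a b ↔
    (w.filter (fun z => decide (z = a ∨ z = b))).IsChain (· ≠ ·) :=
  Iff.rfl

theorem Alternate.symm {w : List V} {a b : V} (h : Alternate w a b) : Alternate w b a := by
  unfold Alternate at *
  simpa only [or_comm] using h

theorem alternate_comm_s5 {w : List V} {a b : V} : Alternate w a b ↔ Alternate w b a :=
  ⟨Alternate.symm, Alternate.symm⟩

theorem Alternate.of_infix {u w : List V} {a b : V} (hu : u <:+: w) (h : Alternate w a b) :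
    Alternate u a b :=
  List.IsChain.infix h (hu.filter _)

/-- A nonempty word without repeated consecutive letters over `{a, b}` starting with `a` ends
with `a` or `b` according to the difference of the numbers of occurrences. -/
theorem getLast_and_count_of_isChain {a b : V} (hab : a ≠ b) (l : List V)
    (hl : ∀ z ∈ l, z = a ∨ z = b) (hc : (a :: l).IsChain (· ≠ ·)) :
    ((a :: l).getLast? = some a ∧ (a :: l).count a = (a :: l).count b + 1) ∨
      ((a :: l).getLast? = some b ∧ (a :: l).count a = (a :: l).count b) := by
  induction l generalizing a b with
  | nil => left; simp [hab]
  | cons c t ih =>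
    rw [List.isChain_cons_cons] at hc
    have hcb : c = b := (hl c (by simp)).resolve_left (Ne.symm hc.1)
    subst hcb
    have := ih hab.symm (fun z hz => (hl z (by simp [hz])).symm) hc.2
    rw [List.getLast?_cons_cons]
    have h1 : (a :: c :: t).count a = (c :: t).count a + 1 := by simp
    have h2 : (a :: c :: t).count c = (c :: t).count c := by simp [hab]
    rw [h1, h2]
    rcases this with ⟨h3, h4⟩ | ⟨h3, h4⟩
    · right; exact ⟨h3, by omega⟩
    · left; exact ⟨h3, by omega⟩

theorem count_filter_pair_left (w : List V) (a b : V) :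
    (w.filter (fun z => decide (z = a ∨ z = b))).count a = w.count a :=
  List.count_filter (by simp)

theorem count_filter_pair_right (w : List V) (a b : V) :
    (w.filter (fun z => decide (z = a ∨ z = b))).count b = w.count b :=
  List.count_filter (by simp)

theorem Alternate.rotate {u v : List V} {a b : V} (hab : a ≠ b)
    (hcount : (u ++ v).count a = (u ++ v).count b) (h : Alternate (u ++ v) a b) :
    Alternate (v ++ u) a b := by
  have hm : ∀ z ∈ (u ++ v).filter (fun z => decide (z = a ∨ z = b)), z = a ∨ z = b := by
    intro z hz
    simpa using (List.mem_filter.1 hz).2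
  rw [← count_filter_pair_left _ a b, ← count_filter_pair_right (u ++ v) a b] at hcount
  unfold Alternate at *
  rw [List.filter_append] at *
  generalize u.filter (fun z => decide (z = a ∨ z = b)) = l at *
  generalize v.filter (fun z => decide (z = a ∨ z = b)) = r at *
  have h' := List.isChain_append.1 h
  refine List.isChain_append.2 ⟨h'.2.1, h'.1, ?_⟩
  intro p hp q hq
  cases l with
  | nil => simp at hq
  | cons c t =>
    have hcq : c = q := by simpa using hq
    subst hcq
    have hlast : (c :: t ++ r).getLast? = some p := by
      rw [List.getLast?_append]
      simp only [Option.mem_def] at hp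
      simp [hp]
    rcases hm c (by simp) with rfl | rfl
    · rcases getLast_and_count_of_isChain hab (t ++ r)
        (fun z hz => hm z (by simp at hz ⊢; tauto)) h with h1 | h1
      · rw [List.cons_append] at hcount; omega
      · rw [List.cons_append, h1.1] at hlast
        cases hlast; exact hab.symm
    · rcases getLast_and_count_of_isChain hab.symm (t ++ r)
        (fun z hz => (hm z (by simp at hz ⊢; tauto)).symm) h with h1 | h1
      · rw [List.cons_append] at hcount; omega
      · rw [List.cons_append, h1.1] at hlast
        cases hlast; exact hab

theorem KUniform.rotate {k : ℕ} {u v : List V} (h : KUniform k (u ++ v)) :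
    KUniform k (v ++ u) := by
  intro z
  rw [← h z, List.count_append, List.count_append, add_comm]

theorem Represents.rotate {G : SimpleGraph V} {k : ℕ} {u v : List V} (hk : KUniform k (u ++ v))
    (h : Represents (u ++ v) G) : Represents (v ++ u) G := by
  refine ⟨fun z => ?_, fun a b hab => ?_⟩
  · have := h.1 z
    simp only [List.mem_append] at this ⊢
    exact this.symm
  · rw [← h.2 a b hab]
    exact ⟨Alternate.rotate hab (by rw [hk.rotate a, hk.rotate b]),
      Alternate.rotate hab (by rw [hk a, hk b])⟩

theorem count_le_one_of_alternate {w : List V} {a b : V} (hb : b ∉ w) (h : Alternate w a b) :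
    w.count a ≤ 1 := by
  rw [← count_filter_pair_left w a b]
  unfold Alternate at h
  have hm : ∀ z ∈ w.filter (fun z => decide (z = a ∨ z = b)), z = a := by
    intro z hz
    rw [List.mem_filter] at hz
    rcases of_decide_eq_true hz.2 with h1 | h1
    · exact h1
    · exact absurd (h1 ▸ hz.1) hb
  generalize w.filter (fun z => decide (z = a ∨ z = b)) = l at *
  match l, h, hm with
  | [], _, _ => simp
  | [c], _, _ => simpa using List.count_le_length (a := a) (l := [c])
  | c :: d :: t, h, hm =>
    have := (List.isChain_cons_cons.1 h).1
    exact absurd ((hm c (by simp)).trans (hm d (by simp)).symm) this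

theorem count_filterMap_of_isPartialInv {f : V → W} {g : W → Option V}
    (hfg : Function.IsPartialInv f g) (w : List W) (a : V) :
    (w.filterMap g).count a = w.count (f a) := by
  induction w with
  | nil => simp
  | cons c t ih =>
    rw [List.filterMap_cons, List.count_cons]
    have := hfg a c
    cases hc : g c with
    | none =>
      have : c ≠ f a := by rintro rfl; simp_all
      simp [ih, this]
    | some d =>
      rw [hc] at this
      rw [Option.some.injEq, eq_comm (a := f a)] at this
      simp only [List.count_cons, ih, beq_iff_eq, this]

theorem alternate_filterMap_iff {f : V → W} {g : W → Option V}
    (hfg : Function.IsPartialInv f g) (w : List W) (a b : V) :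
    Alternate (w.filterMap g) a b ↔ Alternate w (f a) (f b) := by
  have key : ((w.filterMap g).filter (fun z => decide (z = a ∨ z = b))).map f =
      w.filter (fun z => decide (z = f a ∨ z = f b)) := by
    induction w with
    | nil => simp
    | cons c t ih =>
      rw [List.filterMap_cons, List.filter_cons, ← ih]
      have ha := hfg a c
      have hb := hfg b c
      cases hc : g c with
      | none =>
        have h1 : c ≠ f a := by rintro rfl; simp_all
        have h2 : c ≠ f b := by rintro rfl; simp_all
        simp [h1, h2]
      | some d =>
        have hd : f d = c := (hfg d c).1 hc
        rw [hc, Option.some.injEq] at ha hb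
        simp only [List.filter_cons, ha, hb, eq_comm (a := c)]
        split_ifs <;> simp [hd]
  have hf : Function.Injective f := hfg.injective
  rw [alternate_iff, alternate_iff, ← key, List.isChain_map]
  simp only [hf.ne_iff]

theorem KRepresentable.of_embedding {G : SimpleGraph V} {H : SimpleGraph W} {k : ℕ} {f : V → W}
    {g : W → Option V} (hfg : Function.IsPartialInv f g)
    (hadj : ∀ a b, H.Adj (f a) (f b) ↔ G.Adj a b) (h : KRepresentable H k) :
    KRepresentable G k := by
  obtain ⟨w, hw, hr⟩ := h
  refine ⟨w.filterMap g, fun v => ?_, fun v => ?_, fun a b hab => ?_⟩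
  · rw [count_filterMap_of_isPartialInv hfg, hw]
  · exact List.mem_filterMap.2 ⟨f v, hr.1 _, (hfg v _).2 rfl⟩
  · rw [alternate_filterMap_iff hfg, hr.2 _ _ (hfg.injective.ne hab), hadj]

theorem filter_dedup_comm (p : V → Bool) (w : List V) :
    w.dedup.filter p = (w.filter p).dedup := by
  induction w with
  | nil => simp
  | cons c t ih =>
    by_cases hc : c ∈ t <;> by_cases hp : p c = true <;>
      simp [List.dedup_cons_of_mem, List.dedup_cons_of_notMem, hc, hp, ih]

theorem isChain_append_dedup {a b : V} (hab : a ≠ b) (l : List V)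
    (hl : ∀ z ∈ l, z = a ∨ z = b) (ha : a ∈ l) (hb : b ∈ l) (hc : l.IsChain (· ≠ ·)) :
    (l ++ l.dedup).IsChain (· ≠ ·) := by
  induction l with
  | nil => simp at ha
  | cons c t ih =>
    cases t with
    | nil => simp_all
    | cons d s =>
      rw [List.isChain_cons_cons] at hc
      by_cases hct : c ∈ d :: s
      · rw [List.dedup_cons_of_mem hct, List.cons_append, List.cons_append,
          List.isChain_cons_cons]
        refine ⟨hc.1, ih (fun z hz => hl z (List.mem_cons_of_mem _ hz)) ?_ ?_ hc.2⟩
        · rcases List.mem_cons.1 ha with rfl | h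
          exacts [hct, h]
        · rcases List.mem_cons.1 hb with rfl | h
          exacts [hct, h]
      · have hall : ∀ z ∈ d :: s, z = d := by
          intro z hz
          have h1 := hl z (List.mem_cons_of_mem _ hz)
          have h2 := hl d (by simp)
          have h3 := hl c (by simp)
          have h4 : z ≠ c := by rintro rfl; exact hct hz
          have h5 := hc.1
          grind
        cases s with
        | nil => simp [List.dedup_cons_of_notMem hct, hc.1, hc.1.symm]
        | cons e s =>
          exact absurd (hall e (by simp)).symm (List.isChain_cons_cons.1 hc.2).1

theorem getLast_of_count_lt {a b : V} (hab : a ≠ b) {l : List V}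
    (hl : ∀ z ∈ l, z = a ∨ z = b) (hc : l.IsChain (· ≠ ·)) (h : l.count a < l.count b) :
    l.getLast? = some b := by
  cases l with
  | nil => simp at h
  | cons c t =>
    rcases hl c (by simp) with rfl | rfl
    · rcases getLast_and_count_of_isChain hab t (fun z hz => hl z (by simp [hz])) hc with h1 | h1
      · omega
      · omega
    · rcases getLast_and_count_of_isChain hab.symm t
        (fun z hz => (hl z (by simp [hz])).symm) hc with h1 | h1
      · exact h1.1
      · omega

/-- Append to `w`, in the order of last occurrence, the letters occurring fewer than `k` times. -/
def extendWord (k : ℕ) (w : List V) : List V :=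
  w ++ w.dedup.filter (fun z => decide (w.count z < k))

theorem count_extendWord {k : ℕ} {w : List V} {v : V} (hv : v ∈ w) (hk : w.count v ≤ k) :
    (extendWord k w).count v = min (w.count v + 1) k := by
  rw [extendWord, List.count_append]
  by_cases h : w.count v < k
  · rw [List.count_filter (by simpa using h),
      List.count_eq_one_of_mem w.nodup_dedup (List.mem_dedup.2 hv)]
    omega
  · have hz : v ∉ w.dedup.filter (fun z => decide (w.count z < k)) := by
      simp only [List.mem_filter, decide_eq_true_eq]
      exact fun h' => h h'.2
    rw [List.count_eq_zero_of_not_mem hz]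
    omega

theorem alternate_extendWord {k : ℕ} {w : List V} {a b : V}
    (hab : a ≠ b) (ha : a ∈ w) (hb : b ∈ w) (h : Alternate w a b) :
    Alternate (extendWord k w) a b := by
  wlog hle : w.count a ≤ w.count b generalizing a b
  · exact (this hab.symm hb ha h.symm (by omega)).symm
  unfold Alternate at *
  have hm : ∀ z ∈ w.filter (fun z => decide (z = a ∨ z = b)), z = a ∨ z = b := by
    intro z hz
    simpa using (List.mem_filter.1 hz).2
  rw [extendWord, List.filter_append]
  by_cases hbk : w.count b < k
  · have : (w.dedup.filter (fun z => decide (w.count z < k))).filter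
        (fun z => decide (z = a ∨ z = b)) =
        (w.filter (fun z => decide (z = a ∨ z = b))).dedup := by
      rw [← filter_dedup_comm, List.filter_filter]
      apply List.filter_congr
      intro z _
      by_cases hz : z = a ∨ z = b
      · rcases hz with rfl | rfl <;> simp <;> omega
      · simp [hz]
    rw [this]
    exact isChain_append_dedup hab _ hm (by simp [ha]) (by simp [hb]) h
  · by_cases hak : w.count a < k
    · have hlast := getLast_of_count_lt hab hm h
        (by rw [count_filter_pair_left, count_filter_pair_right]; omega)
      have hsub : (w.dedup.filter (fun z => decide (w.count z < k))).filter
          (fun z => decide (z = a ∨ z = b)) = [a] := by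
        rw [List.filter_filter]
        have : w.dedup.filter (· == a) = [a] := by
          rw [List.filter_beq, List.count_eq_one_of_mem w.nodup_dedup (List.mem_dedup.2 ha)]
          rfl
        rw [← this]
        apply List.filter_congr
        intro z _
        by_cases hz : z = a
        · subst hz; simp [hak]
        · by_cases hz' : z = b
          · subst hz'; simp [hz, hbk]
          · simp [hz, hz']
      rw [hsub]
      refine List.isChain_append.2 ?_
      refine ⟨h, by simp, ?_⟩
      rw [hlast]
      simp [hab.symm]
    · have hsub : (w.dedup.filter (fun z => decide (w.count z < k))).filter
          (fun z => decide (z = a ∨ z = b)) = [] := by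
        rw [List.filter_filter, List.filter_eq_nil_iff]
        intro z _
        by_cases hz : z = a ∨ z = b
        · rcases hz with rfl | rfl <;> simp <;> omega
        · simp [hz]
      rw [hsub, List.append_nil]
      exact h

theorem Represents.extendWord {G : SimpleGraph V} {k : ℕ} {w : List V}
    (h : Represents w G) : Represents (extendWord k w) G := by
  refine ⟨fun v => List.mem_append_left _ (h.1 v), fun a b hab => ?_⟩
  rw [← h.2 a b hab]
  exact ⟨Alternate.of_infix (List.prefix_append _ _).isInfix,
    alternate_extendWord hab (h.1 a) (h.1 b)⟩

theorem Represents.kRepresentable {G : SimpleGraph V} {k : ℕ} {w : List V}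
    (hk : ∀ v, w.count v ≤ k) (h : Represents w G) : KRepresentable G k := by
  have key : ∀ n : ℕ, ∃ w' : List V, Represents w' G ∧
      ∀ v, w'.count v ≤ k ∧ min n k ≤ w'.count v := by
    intro n
    induction n with
    | zero => exact ⟨w, h, fun v => ⟨hk v, by simp⟩⟩
    | succ n ih =>
      obtain ⟨w', hr, hc⟩ := ih
      refine ⟨_, hr.extendWord (k := k), fun v => ?_⟩
      rw [count_extendWord (hr.1 v) (hc v).1]
      have := hc v
      omega
  obtain ⟨w', hr, hc⟩ := key k
  exact ⟨w', fun v => by have := hc v; omega, hr⟩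

theorem KRepresentable.mono {G : SimpleGraph V} {k m : ℕ} (hkm : k ≤ m)
    (h : KRepresentable G k) : KRepresentable G m := by
  obtain ⟨w, hw, hr⟩ := h
  exact hr.kRepresentable fun v => (hw v).trans_le hkm

theorem WordRepresentable.kRepresentable_reprNum {G : SimpleGraph V}
    (h : WordRepresentable G) : KRepresentable G (reprNum G) := by
  obtain ⟨w, hr⟩ := h
  exact Nat.sInf_mem (s := {k | KRepresentable G k})
    ⟨w.length, hr.kRepresentable fun v => List.count_le_length⟩

theorem KRepresentable.two_le {G : SimpleGraph V} {k : ℕ} {a b : V} (hab : a ≠ b)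
    (hG : ¬ G.Adj a b) (h : KRepresentable G k) : 2 ≤ k := by
  obtain ⟨w, hw, hr⟩ := h
  by_contra hk
  have hnd : w.Nodup := List.nodup_iff_count_le_one.2 fun v => by rw [hw v]; omega
  exact hG ((hr.2 a b hab).1 (List.Pairwise.isChain (hnd.filter _)))

theorem exists_blocks_concat (x : V) (w : List V) : ∃ (L : List (List V)) (r : List V),
    w = L.flatMap (· ++ [x]) ++ r ∧ x ∉ r ∧ (∀ l ∈ L, x ∉ l) ∧ L.length = w.count x := by
  induction w with
  | nil => exact ⟨[], [], by simp⟩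
  | cons c t ih =>
    obtain ⟨L, r, h1, h2, h3, h4⟩ := ih
    by_cases hc : c = x
    · subst hc
      exact ⟨[] :: L, r, by simp [h1], h2, by simpa using h3, by simp [h4]⟩
    · cases L with
      | nil => exact ⟨[], c :: r, by simp [h1], by simp [h2, Ne.symm hc], by simp,
          by simp [hc, ← h4]⟩
      | cons l L => exact ⟨(c :: l) :: L, r, by simp [h1], h2,
          by simp at h3 ⊢; exact ⟨⟨Ne.symm hc, h3.1⟩, h3.2⟩,
          by simp [hc, ← h4]⟩

theorem exists_blocks_cons (y : V) (w : List V) : ∃ (r : List V) (L : List (List V)),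
    w = r ++ L.flatMap (y :: ·) ∧ y ∉ r ∧ (∀ l ∈ L, y ∉ l) ∧ L.length = w.count y := by
  induction w with
  | nil => exact ⟨[], [], by simp⟩
  | cons c t ih =>
    obtain ⟨r, L, h1, h2, h3, h4⟩ := ih
    by_cases hc : c = y
    · subst hc
      exact ⟨[], r :: L, by simp [h1], by simp, by simpa using ⟨h2, h3⟩, by simp [h4]⟩
    · exact ⟨c :: r, L, by simp [h1], by simp [h2, Ne.symm hc], h3,
          by simp [hc, ← h4]⟩

end Alternation

section Connect

variable {V1 V2 : Type*}

theorem isPartialInv_inl : Function.IsPartialInv (Sum.inl : V1 → V1 ⊕ V2) Sum.getLeft? := by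
  rintro a (b | b) <;> simp [eq_comm]

theorem isPartialInv_inr : Function.IsPartialInv (Sum.inr : V2 → V1 ⊕ V2) Sum.getRight? := by
  rintro a (b | b) <;> simp [eq_comm]

/-- The word `A y x B` on the disjoint union. -/
def connectBlock (x : V1) (y : V2) (p : List V1 × List V2) : List (V1 ⊕ V2) :=
  p.1.map Sum.inl ++ Sum.inr y :: Sum.inl x :: p.2.map Sum.inr

/-- The word `A x A₁ y x B₁ ⋯ Aₙ y x Bₙ y B` on the disjoint union. -/
def connectWord (x : V1) (y : V2) (A : List V1) (P : List (List V1 × List V2)) (B : List V2) :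
    List (V1 ⊕ V2) :=
  A.map Sum.inl ++ Sum.inl x :: (P.flatMap (connectBlock x y) ++ Sum.inr y :: B.map Sum.inr)

theorem filterMap_getLeft_connectWord (x : V1) (y : V2) (A : List V1)
    (P : List (List V1 × List V2)) (B : List V2) :
    (connectWord x y A P B).filterMap Sum.getLeft? =
      A ++ x :: (P.map Prod.fst).flatMap (· ++ [x]) := by
  have hB (l : List V2) : (l.map (Sum.inr : V2 → V1 ⊕ V2)).filterMap Sum.getLeft? = [] := by
    simp [List.filterMap_map, List.filterMap_eq_nil_iff]
  have hA (l : List V1) : (l.map (Sum.inl : V1 → V1 ⊕ V2)).filterMap Sum.getLeft? = l := by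
    rw [List.filterMap_map]
    exact List.filterMap_some
  simp only [connectWord, List.filterMap_append, List.filterMap_cons, Sum.getLeft?, hA, hB,
    List.append_nil]
  congr 2
  induction P with
  | nil => simp
  | cons p P ih =>
    rw [List.flatMap_cons, List.filterMap_append, ih, connectBlock]
    simp only [List.filterMap_append, List.filterMap_cons, Sum.getLeft?, hA, hB]
    simp

theorem filterMap_getRight_connectWord (x : V1) (y : V2) (A : List V1)
    (P : List (List V1 × List V2)) (B : List V2) :
    (connectWord x y A P B).filterMap Sum.getRight? =
      (P.map Prod.snd).flatMap (y :: ·) ++ y :: B := by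
  have hB (l : List V1) : (l.map (Sum.inl : V1 → V1 ⊕ V2)).filterMap Sum.getRight? = [] := by
    simp [List.filterMap_map, List.filterMap_eq_nil_iff]
  have hA (l : List V2) : (l.map (Sum.inr : V2 → V1 ⊕ V2)).filterMap Sum.getRight? = l := by
    rw [List.filterMap_map]
    exact List.filterMap_some
  simp only [connectWord, List.filterMap_append, List.filterMap_cons, Sum.getRight?, hA, hB,
    List.nil_append]
  congr 1
  induction P with
  | nil => simp
  | cons p P ih =>
    rw [List.flatMap_cons, List.filterMap_append, ih, connectBlock]
    simp only [List.filterMap_append, List.filterMap_cons, Sum.getRight?, hA, hB]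
    simp

variable [DecidableEq V1] [DecidableEq V2]

local instance sumBEq : BEq (V1 ⊕ V2) := instBEqOfDecidableEq

theorem count_connectBlock_le_one {x a : V1} {y b : V2} (hab : ¬ (a = x ∧ b = y))
    (p : List V1 × List V2) (h : Alternate (connectBlock x y p) (Sum.inl a) (Sum.inr b)) :
    (connectBlock x y p).count (Sum.inl a) ≤ 1 := by
  by_cases ha : a = x
  · have hb : b ≠ y := fun hb => hab ⟨ha, hb⟩
    have h' : Alternate (p.1.map Sum.inl ++ [Sum.inl x]) (Sum.inl a : V1 ⊕ V2) (Sum.inr b) := by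
      refine Alternate.of_infix (w := p.1.map Sum.inl ++ Sum.inl x :: p.2.map Sum.inr)
        ⟨[], p.2.map Sum.inr, by simp⟩ ?_
      unfold Alternate connectBlock at *
      simpa [List.filter_append, List.filter_cons, hb.symm] using h
    have := count_le_one_of_alternate (by simp) h'
    have hz : (p.2.map Sum.inr).count (Sum.inl a : V1 ⊕ V2) = 0 :=
      List.count_eq_zero_of_not_mem (by simp)
    simpa [connectBlock, List.count_append, List.count_cons, hz] using this
  · have h' : Alternate (p.1.map Sum.inl) (Sum.inl a : V1 ⊕ V2) (Sum.inr b) :=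
      h.of_infix (List.prefix_append _ _).isInfix
    have := count_le_one_of_alternate (by simp) h'
    have hz : (p.2.map Sum.inr).count (Sum.inl a : V1 ⊕ V2) = 0 :=
      List.count_eq_zero_of_not_mem (by simp)
    simpa [connectBlock, List.count_append, List.count_cons, hz, Ne.symm ha] using this

theorem count_flatMap_connectBlock_le {x a : V1} {y b : V2} (hab : ¬ (a = x ∧ b = y))
    (P : List (List V1 × List V2))
    (h : Alternate (P.flatMap (connectBlock x y)) (Sum.inl a) (Sum.inr b)) :
    (P.flatMap (connectBlock x y)).count (Sum.inl a) ≤ P.length := by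
  induction P with
  | nil => simp
  | cons p P ih =>
    rw [List.flatMap_cons] at *
    have h1 := count_connectBlock_le_one hab p (h.of_infix (List.prefix_append _ _).isInfix)
    have h2 := ih (h.of_infix (List.suffix_append _ _).isInfix)
    rw [List.count_append, List.length_cons]
    omega

theorem alternate_connectWord {x : V1} {y : V2} {A : List V1} {P : List (List V1 × List V2)}
    {B : List V2} (hA : x ∉ A) (hB : y ∉ B) (hP : ∀ p ∈ P, x ∉ p.1 ∧ y ∉ p.2) :
    Alternate (connectWord x y A P B) (Sum.inl x) (Sum.inr y) := by
  have hl (l : List V1) (h : x ∉ l) : (l.map Sum.inl).filter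
      (fun z : V1 ⊕ V2 => decide (z = Sum.inl x ∨ z = Sum.inr y)) = [] := by
    simp [List.filter_eq_nil_iff]; rintro a ha rfl; exact h ha
  have hr (l : List V2) (h : y ∉ l) : (l.map Sum.inr).filter
      (fun z : V1 ⊕ V2 => decide (z = Sum.inl x ∨ z = Sum.inr y)) = [] := by
    simp [List.filter_eq_nil_iff]; rintro a ha rfl; exact h ha
  rw [alternate_iff, connectWord, List.filter_append, hl A hA, List.nil_append, List.filter_cons_of_pos (by simp),
    List.filter_append, List.filter_cons_of_pos (by simp), hr B hB]
  induction P with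
  | nil => simp
  | cons p P ih =>
    have hp := hP p (by simp)
    have := ih fun q hq => hP q (by simp [hq])
    rw [List.flatMap_cons, connectBlock, List.filter_append, List.filter_append, hl _ hp.1,
      List.nil_append, List.filter_cons_of_pos (by simp), List.filter_cons_of_pos (by simp),
      hr _ hp.2]
    exact List.isChain_cons_cons.2 ⟨by simp, List.isChain_cons_cons.2 ⟨by simp, this⟩⟩

theorem not_alternate_connectWord {x a : V1} {y b : V2} (hab : ¬ (a = x ∧ b = y))
    {A : List V1} {P : List (List V1 × List V2)} {B : List V2} (hP : P ≠ [])
    (hc : P.length < (connectWord x y A P B).count (Sum.inl a)) :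
    ¬ Alternate (connectWord x y A P B) (Sum.inl a) (Sum.inr b) := by
  intro h
  obtain ⟨p, Q, rfl⟩ := List.exists_cons_of_ne_nil hP
  have hw : connectWord x y A (p :: Q) B =
      ((A ++ x :: p.1, p.2) :: Q).flatMap (connectBlock x y) ++ Sum.inr y :: B.map Sum.inr := by
    simp [connectWord, connectBlock]
  rw [hw] at h hc
  have := count_flatMap_connectBlock_le hab _ (h.of_infix (List.prefix_append _ _).isInfix)
  have hz : (Sum.inr y :: B.map Sum.inr).count (Sum.inl a : V1 ⊕ V2) = 0 :=
    List.count_eq_zero_of_not_mem (by simp)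
  rw [List.count_append, hz] at hc
  simp only [List.length_cons] at hc this
  omega

theorem KRepresentable.connect_by_edge {G1 : SimpleGraph V1} {G2 : SimpleGraph V2} {k : ℕ}
    (hk : 2 ≤ k) (h1 : KRepresentable G1 k) (h2 : KRepresentable G2 k) {x : V1} {y : V2}
    {G' : SimpleGraph (V1 ⊕ V2)}
    (hll : ∀ a b : V1, G'.Adj (Sum.inl a) (Sum.inl b) ↔ G1.Adj a b)
    (hrr : ∀ a b : V2, G'.Adj (Sum.inr a) (Sum.inr b) ↔ G2.Adj a b)
    (hlr : ∀ (a : V1) (b : V2), G'.Adj (Sum.inl a) (Sum.inr b) ↔ (a = x ∧ b = y)) :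
    KRepresentable G' k := by
  obtain ⟨w1, hu1, hr1⟩ := h1
  obtain ⟨w2, hu2, hr2⟩ := h2
  obtain ⟨L1, A', rfl, hA', hL1, hlen1⟩ := exists_blocks_concat x w1
  obtain ⟨B', L2, rfl, hB', hL2, hlen2⟩ := exists_blocks_cons y w2
  rw [hu1] at hlen1
  rw [hu2] at hlen2
  have hr1 := hr1.rotate hu1
  have hu1 := hu1.rotate
  have hr2 := hr2.rotate hu2
  have hu2 := hu2.rotate
  obtain ⟨A, L1, rfl⟩ := List.exists_cons_of_ne_nil (l := L1) (by rintro rfl; simp at hlen1; omega)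
  obtain ⟨L2, B, rfl⟩ : ∃ L B, L2 = L ++ [B] :=
    (List.eq_nil_or_concat' L2).resolve_left (by rintro rfl; simp at hlen2; omega)
  simp only [List.length_cons, List.length_append, List.length_nil] at hlen1 hlen2
  have hfst : (L1.zip L2).map Prod.fst = L1 := List.map_fst_zip (by omega)
  have hsnd : (L1.zip L2).map Prod.snd = L2 := List.map_snd_zip (by omega)
  have hlen : (L1.zip L2).length = k - 1 := by simp; omega
  have hPmem : ∀ p ∈ L1.zip L2, x ∉ p.1 ∧ y ∉ p.2 := fun p hp =>
    ⟨hL1 _ (List.mem_cons_of_mem _ (List.of_mem_zip hp).1),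
      hL2 _ (List.mem_append_left _ (List.of_mem_zip hp).2)⟩
  generalize L1.zip L2 = P at *
  subst hfst hsnd
  set w := connectWord x y (A' ++ A) P (B ++ B') with hw
  have hleft : w.filterMap Sum.getLeft? =
      A' ++ (A :: P.map Prod.fst).flatMap (· ++ [x]) := by
    rw [hw, filterMap_getLeft_connectWord]; simp
  have hright : w.filterMap Sum.getRight? =
      (P.map Prod.snd ++ [B]).flatMap (y :: ·) ++ B' := by
    rw [hw, filterMap_getRight_connectWord]; simp
  rw [← hleft] at hr1 hu1
  rw [← hright] at hr2 hu2
  have hul : ∀ a : V1, w.count (Sum.inl a) = k := fun a => by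
    rw [← count_filterMap_of_isPartialInv isPartialInv_inl, hu1]
  have hur : ∀ b : V2, w.count (Sum.inr b) = k := fun b => by
    rw [← count_filterMap_of_isPartialInv isPartialInv_inr, hu2]
  have hu : KUniform k w := by
    rintro (a | b)
    exacts [hul a, hur b]
  have hcross : ∀ (a : V1) (b : V2),
      Alternate w (Sum.inl a) (Sum.inr b) ↔ (a = x ∧ b = y) := by
    intro a b
    constructor
    · intro h
      by_contra hab
      refine not_alternate_connectWord hab ?_ ?_ h
      · rintro rfl; simp at hlen; omega
      · rw [← hw, hul]; omega
    · rintro ⟨rfl, rfl⟩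
      apply alternate_connectWord _ _ hPmem
      · simp [hA', hL1 A (by simp)]
      · simp [hB', hL2 B (by simp)]
  refine ⟨w, hu, fun v => List.count_pos_iff.1 (by rw [hu v]; omega), ?_⟩
  rintro (a | a) (b | b) hab
  · rw [hll, ← alternate_filterMap_iff isPartialInv_inl, hr1.2 a b (by simpa using hab)]
  · rw [hlr, hcross]
  · rw [G'.adj_comm, hlr, alternate_comm_s5, hcross]
  · rw [hrr, ← alternate_filterMap_iff isPartialInv_inr, hr2.2 a b (by simpa using hab)]

end Connect

/-- Connecting two word-representable graphs `G1`, `G2` (each with at least two vertices,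
with representation numbers `k1` and `k2`) by the single edge `(x, y)` yields a
word-representable graph with representation number `max (max k1 k2) 2`.
The connected graph `G'` lives on the disjoint union `V1 ⊕ V2`. -/
theorem reprNum_connect_by_edge {V1 V2 : Type*} [DecidableEq V1] [DecidableEq V2]
    [Fintype V1] [Fintype V2]
    (G1 : SimpleGraph V1) (G2 : SimpleGraph V2)
    (hcard1 : 2 ≤ Fintype.card V1) (hcard2 : 2 ≤ Fintype.card V2)
    (hw1 : WordRepresentable G1) (hw2 : WordRepresentable G2)
    (k1 k2 : ℕ) (hk1 : reprNum G1 = k1) (hk2 : reprNum G2 = k2)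
    (x : V1) (y : V2) (G' : SimpleGraph (V1 ⊕ V2))
    (hll : ∀ a b : V1, G'.Adj (Sum.inl a) (Sum.inl b) ↔ G1.Adj a b)
    (hrr : ∀ a b : V2, G'.Adj (Sum.inr a) (Sum.inr b) ↔ G2.Adj a b)
    (hlr : ∀ (a : V1) (b : V2), G'.Adj (Sum.inl a) (Sum.inr b) ↔ (a = x ∧ b = y)) :
    WordRepresentable G' ∧ reprNum G' = max (max k1 k2) 2 := by
  subst hk1 hk2
  have hK : KRepresentable G' (max (max (reprNum G1) (reprNum G2)) 2) :=
    KRepresentable.connect_by_edge (le_max_right _ _)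
      (hw1.kRepresentable_reprNum.mono (by omega)) (hw2.kRepresentable_reprNum.mono (by omega))
      hll hrr hlr
  have hG' : WordRepresentable G' := hK.imp fun _ h => h.2
  refine ⟨hG', le_antisymm (Nat.sInf_le hK) ?_⟩
  have hR := hG'.kRepresentable_reprNum
  have : Nontrivial V1 := Fintype.one_lt_card_iff_nontrivial.1 hcard1
  obtain ⟨a, ha⟩ := exists_ne x
  refine max_le (max_le ?_ ?_) ?_
  · exact Nat.sInf_le (hR.of_embedding isPartialInv_inl hll)
  · exact Nat.sInf_le (hR.of_embedding isPartialInv_inr hrr)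
  · exact hR.two_le (a := Sum.inl a) (b := Sum.inr y) (by simp) fun h => ha ((hlr a y).1 h).1
end
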